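/- Let α ∈ (0,1], let (X,d) be a compact metric space, and let F be a topological space whose elements are (identified with) Lipschitz self-maps of X. Suppose f ∈ F is F-stably hyperbolic, φ ∈ C^α(X,ℝ) is nonconstant, and (f,φ) has the locking property with respect to C^α(X,ℝ). Then (f,φ) lies in the interior of the joint locking set: there exist a neighbourhood U of f in F and ε > 0 such that every pair (g,ψ) with g ∈ U and ‖ψ−φ‖_α < ε has the locking property with respect to C^α(X,ℝ). -/

import Mathlib

open MeasureTheory Set Filter

section Defs

variable {X : Type*} [MetricSpace X]

/-- The nonwandering set of a self-map `f`. -/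
def nonwanderingSet (f : X → X) : Set X :=
  {x | ∀ U ∈ nhds x, ∃ n : ℕ, 1 ≤ n ∧ ∃ y ∈ U, f^[n] y ∈ U}

/-- The (smallest) Lipschitz constant of `f`. -/
noncomputable def lipConst (f : X → X) : ℝ :=
  sInf {K : ℝ | 0 ≤ K ∧ ∀ x y, dist (f x) (f y) ≤ K * dist x y}

/-- `φ` is `α`-Hölder on `S`. -/
def IsHolderOn (α : ℝ) (S : Set X) (φ : X → ℝ) : Prop :=
  ∃ C : ℝ, ∀ x ∈ S, ∀ y ∈ S, |φ x - φ y| ≤ C * dist x y ^ α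

/-- Pointwise `α`-Hölder bound with constant `C` on `S`. -/
def HolderBoundOn (C α : ℝ) (S : Set X) (φ : X → ℝ) : Prop :=
  ∀ x ∈ S, ∀ y ∈ S, |φ x - φ y| ≤ C * dist x y ^ α

/-- The `α`-Hölder seminorm of `φ` on `S`. -/
noncomputable def holderSemiOn (α : ℝ) (S : Set X) (φ : X → ℝ) : ℝ :=
  sInf {C : ℝ | 0 ≤ C ∧ ∀ x ∈ S, ∀ y ∈ S, |φ x - φ y| ≤ C * dist x y ^ α}

/-- The sup-norm of `φ` on `S`. -/
noncomputable def supNormOn (S : Set X) (φ : X → ℝ) : ℝ :=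
  sSup ((fun x => |φ x|) '' S)

/-- The `α`-Hölder norm `‖φ‖_α = sup|φ| + ⌈φ⌉_α` on `S`. -/
noncomputable def holderNormOn (α : ℝ) (S : Set X) (φ : X → ℝ) : ℝ :=
  supNormOn S φ + holderSemiOn α S φ

variable [MeasurableSpace X]

/-- `μ` is an `f`-invariant Borel probability measure. -/
def IsInvProb (f : X → X) (μ : Measure X) : Prop :=
  IsProbabilityMeasure μ ∧ μ.map f = μ

/-- The maximum ergodic average `Q(f, φ)`. -/
noncomputable def maxErgAvg (f : X → X) (φ : X → ℝ) : ℝ :=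
  sSup {r : ℝ | ∃ μ : Measure X, IsInvProb f μ ∧ r = ∫ x, φ x ∂μ}

/-- The set of `(f, φ)`-maximizing measures. -/
def maxMeasures (f : X → X) (φ : X → ℝ) : Set (Measure X) :=
  {μ : Measure X | IsInvProb f μ ∧ ∫ x, φ x ∂μ = maxErgAvg f φ}

/-- The uniform probability measure `μ_O` on a finite set `O`. -/
noncomputable def orbitMeasure (O : Finset X) : Measure X :=
  (O.card : ENNReal)⁻¹ • ∑ x ∈ O, Measure.dirac x

/-- `O` is an `f`-periodic orbit. -/
def IsPeriodicOrbit [DecidableEq X] (f : X → X) (O : Finset X) : Prop :=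
  ∃ x p, 0 < p ∧ f^[p] x = x ∧ O = (Finset.range p).image fun i => f^[i] x

/-- The periodic optimization (PO) property: the unique maximizing measure
is supported on a single periodic orbit. -/
def HasPO [DecidableEq X] (f : X → X) (φ : X → ℝ) : Prop :=
  ∃ O : Finset X, IsPeriodicOrbit f O ∧ maxMeasures f φ = {orbitMeasure O}

/-- The locking property of `(f, φ)` with respect to `C^α(X, ℝ)`. -/
def HasLocking [DecidableEq X] (α : ℝ) (f : X → X) (φ : X → ℝ) : Prop :=
  HasPO f φ ∧ ∃ ε > (0:ℝ), ∀ ψ : X → ℝ, IsHolderOn α univ ψ →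
    holderNormOn α univ (fun x => ψ x - φ x) < ε → maxMeasures f ψ = maxMeasures f φ

/-- `f` is `𝓕`-stably hyperbolic: (IS) intertwining stability, (RHE) robust
hyperbolic estimates, and (ML) the Mañé lemma. -/
def StablyHyperbolic {F : Type*} [TopologicalSpace F] (ι : F → X → X) (f : F) : Prop :=
  -- (IS)
  (∀ ε > (0:ℝ), ∃ U ∈ nhds f, ∀ g ∈ U,
    lipConst (ι g) < 2 * lipConst (ι f) ∧
    ∃ h i : X → X,
      MapsTo h (nonwanderingSet (ι f)) (nonwanderingSet (ι g)) ∧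
      MapsTo i (nonwanderingSet (ι g)) (nonwanderingSet (ι f)) ∧
      (∀ x ∈ nonwanderingSet (ι f), h (ι f x) = ι g (h x)) ∧
      (∀ x ∈ nonwanderingSet (ι g), i (ι g x) = ι f (i x)) ∧
      (∀ x ∈ nonwanderingSet (ι f), dist (h x) x < ε) ∧
      (∀ x ∈ nonwanderingSet (ι g), dist (i x) x < ε)) ∧
  -- (RHE)
  (∃ U ∈ nhds f, ∃ K > (0:ℝ), ∃ δ > (0:ℝ), ∃ lam > (1:ℝ), ∀ g ∈ U,
    ∀ x ∈ nonwanderingSet (ι g), ∀ y ∈ nonwanderingSet (ι g), ∀ n : ℕ,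
      (∀ m ≤ n, dist ((ι g)^[m] x) ((ι g)^[m] y) < δ) →
      ∀ m ≤ n, dist ((ι g)^[m] x) ((ι g)^[m] y) ≤
        K * (lam ^ min m (n - m))⁻¹ *
          (dist x y + dist ((ι g)^[n] x) ((ι g)^[n] y))) ∧
  -- (ML)
  (∀ β : ℝ, 0 < β → β ≤ 1 → ∃ L > (0:ℝ), ∀ φ : X → ℝ, IsHolderOn β univ φ →
    ∃ u : X → ℝ,
      (∀ z ∈ nonwanderingSet (ι f), φ z + u z - u (ι f z) ≤ maxErgAvg (ι f) φ) ∧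
      HolderBoundOn (L * holderSemiOn β univ φ) β (nonwanderingSet (ι f)) u)

end Defs

section Iterate

variable {X : Type*}

theorem iterate_iterate_eq {f : X → X} {x : X} {p : ℕ} (hx : f^[p] x = x) (j : ℕ) :
    f^[p] (f^[j] x) = f^[j] x := by
  rw [← Function.iterate_add_apply, add_comm, Function.iterate_add_apply, hx]

theorem iterate_mod_eq {f : X → X} {x : X} {p : ℕ} (hx : f^[p] x = x) (j : ℕ) :
    f^[j % p] x = f^[j] x :=
  Function.IsPeriodicPt.iterate_mod_apply hx j

theorem finite_range_iterate {f : X → X} {x : X} {p : ℕ} (hp : 0 < p) (hx : f^[p] x = x) :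
    (range fun j => f^[j] x).Finite := by
  refine ((Set.finite_lt_nat p).image fun j => f^[j] x).subset ?_
  rintro _ ⟨j, rfl⟩
  exact ⟨j % p, Nat.mod_lt _ hp, iterate_mod_eq hx j⟩

end Iterate

section Holder

theorem supNormOn_nonneg {X : Type*} (S : Set X) (φ : X → ℝ) : 0 ≤ supNormOn S φ := by
  refine Real.sSup_nonneg ?_
  rintro _ ⟨x, -, rfl⟩
  exact abs_nonneg _

variable {X : Type*} [MetricSpace X] {α : ℝ}

theorem continuous_of_holder (hα : 0 < α) {C : ℝ} {ψ : X → ℝ}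
    (hψ : ∀ x y, |ψ x - ψ y| ≤ C * dist x y ^ α) : Continuous ψ := by
  rw [continuous_iff_continuousAt]
  intro x
  rw [ContinuousAt, tendsto_iff_dist_tendsto_zero]
  refine squeeze_zero (fun _ => dist_nonneg) (fun y => (Real.dist_eq _ _).trans_le (hψ y x)) ?_
  have h : Continuous fun y => C * dist y x ^ α :=
    continuous_const.mul
      ((continuous_id.dist continuous_const).rpow_const fun _ => Or.inr hα.le)
  simpa [Real.zero_rpow hα.ne'] using h.tendsto x

theorem IsHolderOn.exists_nonneg {S : Set X} {φ : X → ℝ} (h : IsHolderOn α S φ) :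
    ∃ C : ℝ, 0 ≤ C ∧ ∀ x ∈ S, ∀ y ∈ S, |φ x - φ y| ≤ C * dist x y ^ α := by
  obtain ⟨C, hC⟩ := h
  refine ⟨max C 0, le_max_right _ _, fun x hx y hy => (hC x hx y hy).trans ?_⟩
  gcongr
  exact le_max_left _ _

theorem IsHolderOn.sub {S : Set X} {φ ψ : X → ℝ} (h : IsHolderOn α S φ)
    (h' : IsHolderOn α S ψ) : IsHolderOn α S fun x => φ x - ψ x := by
  obtain ⟨C, hC⟩ := h
  obtain ⟨C', hC'⟩ := h'
  refine ⟨C + C', fun x hx y hy => ?_⟩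
  have h1 := hC x hx y hy
  have h2 := hC' x hx y hy
  rw [abs_le] at *
  constructor <;> linarith

theorem holderSemiOn_nonneg (S : Set X) (φ : X → ℝ) : 0 ≤ holderSemiOn α S φ :=
  Real.sInf_nonneg fun _ h => h.1

theorem bounds_of_holderNormOn_lt [CompactSpace X] (hα : 0 < α) {χ : X → ℝ} {ε : ℝ}
    (hχ : IsHolderOn α univ χ) (h : holderNormOn α univ χ < ε) :
    (∀ x, |χ x| ≤ ε) ∧ ∀ x y, |χ x - χ y| ≤ ε * dist x y ^ α := by
  obtain ⟨C, hC0, hC⟩ := hχ.exists_nonneg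
  have hcont : Continuous χ := continuous_of_holder hα fun x y => hC x trivial y trivial
  have h1 := holderSemiOn_nonneg (α := α) univ χ
  have h2 := supNormOn_nonneg univ χ
  unfold holderNormOn at h
  constructor
  · intro x
    have hb : BddAbove ((fun x => |χ x|) '' univ) :=
      (isCompact_univ.image hcont.abs).bddAbove
    have : |χ x| ≤ supNormOn univ χ := le_csSup hb ⟨x, trivial, rfl⟩
    linarith
  · intro x y
    have h3 : holderSemiOn α univ χ < ε := by linarith
    unfold holderSemiOn at h3
    obtain ⟨C', ⟨-, hC'⟩, hlt⟩ := exists_lt_of_csInf_lt (by exact ⟨C, hC0, hC⟩) h3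
    refine (hC' x trivial y trivial).trans ?_
    gcongr

theorem holderNormOn_le {χ : X → ℝ} {A B : ℝ} (hA : 0 ≤ A) (hB : 0 ≤ B)
    (h1 : ∀ x, |χ x| ≤ A) (h2 : ∀ x y, |χ x - χ y| ≤ B * dist x y ^ α) :
    holderNormOn α univ χ ≤ A + B := by
  have hS : holderSemiOn α univ χ ≤ B := by
    unfold holderSemiOn
    exact csInf_le ⟨0, fun _ h => h.1⟩ ⟨hB, fun x _ y _ => h2 x y⟩
  refine add_le_add (Real.sSup_le ?_ hA) hS
  rintro _ ⟨x, -, rfl⟩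
  exact h1 x

theorem abs_infDist_rpow_sub_le (hα0 : 0 < α) (hα1 : α ≤ 1) (s : Set X) (x y : X) :
    |Metric.infDist x s ^ α - Metric.infDist y s ^ α| ≤ dist x y ^ α := by
  have key : ∀ x y, Metric.infDist x s ^ α - Metric.infDist y s ^ α ≤ dist x y ^ α := by
    intro x y
    have h1 : Metric.infDist x s ^ α ≤ (Metric.infDist y s + dist x y) ^ α :=
      Real.rpow_le_rpow Metric.infDist_nonneg Metric.infDist_le_infDist_add_dist hα0.le
    have h2 := Real.rpow_add_le_add_rpow (Metric.infDist_nonneg (x := y) (s := s))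
      (dist_nonneg (x := x) (y := y)) hα0.le hα1
    linarith
  rw [abs_le]
  have := key y x
  rw [dist_comm] at this
  exact ⟨by linarith, key x y⟩

theorem dist_map_le_lipConst {f : X → X} (hf : ∃ K : NNReal, LipschitzWith K f) (x y : X) :
    dist (f x) (f y) ≤ lipConst f * dist x y := by
  obtain ⟨K, hK⟩ := hf
  rcases (dist_nonneg (x := x) (y := y)).eq_or_lt with h | h
  · have : x = y := dist_eq_zero.1 h.symm
    simp [this]
  · rw [← div_le_iff₀ h]
    refine le_csInf ⟨K, K.2, fun x y => hK.dist_le_mul x y⟩ ?_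
    rintro L ⟨-, hL⟩
    rw [div_le_iff₀ h]
    exact hL x y

theorem lipConst_nonneg (f : X → X) : 0 ≤ lipConst f :=
  Real.sInf_nonneg fun _ h => h.1

end Holder

section Nonwandering

variable {X : Type*} [MetricSpace X]

theorem mapsTo_nonwanderingSet {f : X → X} (hf : Continuous f) :
    MapsTo f (nonwanderingSet f) (nonwanderingSet f) := by
  intro x hx U hU
  obtain ⟨n, hn, y, hy, hy'⟩ := hx _ (hf.continuousAt.preimage_mem_nhds hU)
  refine ⟨n, hn, f y, hy, ?_⟩
  rw [← Function.iterate_succ_apply, Function.iterate_succ_apply']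
  exact hy'

theorem mem_nonwanderingSet_of_iterate_eq {f : X → X} {x : X} {p : ℕ} (hp : 0 < p)
    (hx : f^[p] x = x) : x ∈ nonwanderingSet f := fun _ hU =>
  ⟨p, hp, x, mem_of_mem_nhds hU, by rw [hx]; exact mem_of_mem_nhds hU⟩

theorem IsInvProb.ae_mem_nonwanderingSet [CompactSpace X] [MeasurableSpace X] [BorelSpace X]
    {f : X → X} (hf : Continuous f) {μ : Measure X} (hμ : IsInvProb f μ) :
    ∀ᵐ x ∂μ, x ∈ nonwanderingSet f := by
  have := hμ.1
  have hp : MeasurePreserving f μ μ := ⟨hf.measurable, hμ.2⟩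
  filter_upwards [hp.conservative.ae_frequently_mem_of_mem_nhds] with x hx U hU
  obtain ⟨n, hn, hn'⟩ := (hx U hU).forall_exists_of_atTop 1
  exact ⟨n, hn, x, mem_of_mem_nhds hU, hn'⟩

end Nonwandering

section Sums

theorem sum_range_le_of_excursions {b D : ℕ → ℝ} {r R c : ℝ} (hc : 0 ≤ c) (hrR : r ≤ R)
    (hmid : ∀ k, r ≤ D k → b k ≤ 0) (hfar : ∀ k, R ≤ D k → b k ≤ -c)
    (hnear : ∀ a n, a ≤ n → D a < r → D n < r → (∀ j, a ≤ j → j ≤ n → D j < R) →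
      ∑ k ∈ Finset.Ico a (n + 1), b k ≤ c) (n : ℕ) :
    ∑ k ∈ Finset.range n, b k ≤ c := by
  suffices h : ∑ k ∈ Finset.range n, b k ≤ 0 ∨ (∑ k ∈ Finset.range n, b k ≤ c ∧
      ∃ a < n, ∑ k ∈ Finset.range a, b k ≤ 0 ∧ D a < r ∧ ∀ j, a ≤ j → j < n → D j < R) by
    rcases h with h | h
    · exact h.trans hc
    · exact h.1
  induction n with
  | zero => simp
  | succ n ih =>
    rcases ih with ih | ⟨ih, a, han, ha, hDa, hD⟩
    · rcases lt_or_ge (D n) r with h | h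
      · right
        have hD : ∀ j, n ≤ j → j ≤ n → D j < R := fun j h1 h2 => by
          rw [le_antisymm h2 h1]; exact h.trans_le hrR
        have := hnear n n le_rfl h h hD
        simp only [Nat.Ico_succ_singleton, Finset.sum_singleton] at this
        refine ⟨by rw [Finset.sum_range_succ]; linarith, n, n.lt_succ_self, ih, h, ?_⟩
        exact fun j h1 h2 => hD j h1 (Nat.lt_succ_iff.1 h2)
      · left
        rw [Finset.sum_range_succ]
        linarith [hmid n h]
    · rcases lt_or_ge (D n) R with hR | hR
      · right
        have hD' : ∀ j, a ≤ j → j ≤ n → D j < R := fun j h1 h2 => by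
          rcases h2.eq_or_lt with rfl | h2
          · exact hR
          · exact hD j h1 h2
        refine ⟨?_, a, by lia, ha, hDa, fun j h1 h2 => hD' j h1 (Nat.lt_succ_iff.1 h2)⟩
        rcases lt_or_ge (D n) r with h | h
        · have := hnear a n han.le hDa h hD'
          rw [← Finset.sum_range_add_sum_Ico _ (by lia : a ≤ n + 1)]
          linarith
        · rw [Finset.sum_range_succ]
          linarith [hmid n h]
      · left
        rw [Finset.sum_range_succ]
        linarith [hfar n hR]

theorem sum_range_shift_eq_of_periodic {M : Type*} [AddCommMonoid M] {e : ℕ → M} {P : ℕ}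
    (hper : ∀ j, e (j + P) = e j) (j : ℕ) :
    ∑ m ∈ Finset.range P, e (m + j) = ∑ m ∈ Finset.range P, e m := by
  induction j with
  | zero => simp
  | succ j ih =>
    rw [← ih]
    cases P with
    | zero => simp
    | succ P =>
      rw [Finset.sum_range_succ, Finset.sum_range_succ', show P + (j + 1) = j + (P + 1) by ring,
        hper, zero_add]
      congr 1
      exact Finset.sum_congr rfl fun m _ => by congr 1; ring

theorem sum_range_le_of_periodic {e : ℕ → ℝ} {P : ℕ} (hP : 0 < P)
    (hper : ∀ j, e (j + P) = e j) (hsum : ∑ m ∈ Finset.range P, e m ≤ 0) {η : ℝ}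
    (hη : 0 ≤ η) (he : ∀ j, e j ≤ η) (N : ℕ) : ∑ m ∈ Finset.range N, e m ≤ P * η := by
  induction N using Nat.strong_induction_on with
  | _ N ih =>
    rcases lt_or_ge N P with h | h
    · calc ∑ m ∈ Finset.range N, e m ≤ ∑ m ∈ Finset.range N, η :=
            Finset.sum_le_sum fun _ _ => he _
        _ = N * η := by simp
        _ ≤ P * η := by gcongr
    · obtain ⟨M, rfl⟩ := Nat.exists_eq_add_of_le h
      rw [Finset.sum_range_add]
      have := ih M (by lia)
      simp only [add_comm P, hper]
      linarith

theorem sum_le_of_two_sided_decay {α C K lam ρ : ℝ} (hα : 0 < α) (hC : 0 ≤ C) (hK : 0 ≤ K)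
    (hlam : 1 < lam) (hρ : 0 ≤ ρ) {n : ℕ} {w d : ℕ → ℝ} (hd0 : ∀ m, 0 ≤ d m)
    (hw : ∀ m, w m ≤ C * d m ^ α)
    (hd : ∀ m ≤ n, d m ≤ K * (lam ^ min m (n - m))⁻¹ * ρ) :
    ∑ m ∈ Finset.range (n + 1), w m ≤
      C * (K * ρ) ^ α * (2 * (1 - (lam⁻¹) ^ α)⁻¹) := by
  set θ : ℝ := (lam⁻¹) ^ α with hθ
  have hlam0 : 0 < lam := by linarith
  have hθ0 : 0 ≤ θ := by positivity
  have hθ1 : θ < 1 := Real.rpow_lt_one (by positivity) (inv_lt_one_of_one_lt₀ hlam) hα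
  have hgeom : ∑ m ∈ Finset.range (n + 1), θ ^ m ≤ (1 - θ)⁻¹ := by
    rw [← tsum_geometric_of_lt_one hθ0 hθ1]
    exact (summable_geometric_of_lt_one hθ0 hθ1).sum_le_tsum _ fun _ _ => by positivity
  have hterm : ∀ m ∈ Finset.range (n + 1),
      w m ≤ C * (K * ρ) ^ α * (θ ^ m + θ ^ (n + 1 - 1 - m)) := by
    intro m hm
    have hm' : m ≤ n := Nat.lt_succ_iff.1 (Finset.mem_range.1 hm)
    have hmin : θ ^ min m (n - m) ≤ θ ^ m + θ ^ (n - m) := by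
      have := pow_nonneg hθ0 m
      have := pow_nonneg hθ0 (n - m)
      rcases min_choice m (n - m) with h | h <;> rw [h] <;> linarith
    calc w m ≤ C * d m ^ α := hw m
      _ ≤ C * (K * (lam ^ min m (n - m))⁻¹ * ρ) ^ α := by
          gcongr
          · exact hd0 m
          · exact hd m hm'
      _ = C * (K * ρ) ^ α * θ ^ min m (n - m) := by
          rw [mul_right_comm, Real.mul_rpow (by positivity) (by positivity), hθ,
            Real.rpow_pow_comm (by positivity), inv_pow]
          ring
      _ ≤ _ := by
          rw [Nat.add_sub_cancel]
          gcongr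
  refine (Finset.sum_le_sum hterm).trans ?_
  rw [← Finset.mul_sum, Finset.sum_add_distrib, Finset.sum_range_reflect (fun m => θ ^ m)]
  have : 0 ≤ C * (K * ρ) ^ α := by positivity
  gcongr
  linarith

end Sums

theorem Set.Finite.exists_pos_le_dist {X : Type*} [MetricSpace X] {S : Set X} (hS : S.Finite) :
    ∃ s > (0 : ℝ), ∀ x ∈ S, ∀ y ∈ S, x ≠ y → s ≤ dist x y := by
  rcases S.subsingleton_or_nontrivial with h | h
  · exact ⟨1, one_pos, fun x hx y hy hne => absurd (h hx hy) hne⟩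
  · exact ⟨S.infsep, hS.infsep_pos_iff_nontrivial.2 h,
      fun x hx y hy hne => Set.infsep_le_dist_of_mem hx hy hne⟩

section Comparison

variable {X : Type*} [MetricSpace X]

theorem dist_iterate_lt_of_shadow {f g : X → X} {x₀ z x : X} {R ε Λ : ℝ} (hΛ0 : 0 ≤ Λ)
    (hΛ : ∀ x y, dist (g x) (g y) ≤ Λ * dist x y)
    (hzd : ∀ j, dist (g^[j] z) (f^[j] x₀) < ε)
    (hsep : ∀ j k, f^[j] x₀ ≠ f^[k] x₀ →
      2 * R + Λ * (R + ε) + ε ≤ dist (f^[j] x₀) (f^[k] x₀))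
    {n j₀ : ℕ} (hx : dist x (f^[j₀] x₀) < R)
    (hn : ∀ m ≤ n, Metric.infDist (g^[m] x) (range fun j => f^[j] x₀) < R) :
    ∀ m ≤ n, dist (g^[m] x) (f^[m + j₀] x₀) < R := by
  intro m
  induction m with
  | zero => intro _; simpa using hx
  | succ m ih =>
    intro hm
    have h1 := ih (by lia)
    obtain ⟨_, ⟨k, rfl⟩, hk⟩ := (Metric.infDist_lt_iff (range_nonempty _)).1 (hn _ hm)
    by_cases hne : f^[m + 1 + j₀] x₀ = f^[k] x₀
    · rw [hne]; exact hk
    · exfalso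
      have h2 := hsep _ _ hne
      have h3 : dist (g^[m] x) (g^[m + j₀] z) ≤ R + ε := by
        have := dist_triangle_right (g^[m] x) (g^[m + j₀] z) (f^[m + j₀] x₀)
        linarith [hzd (m + j₀)]
      have h4 : dist (g^[m + 1] x) (g^[m + 1 + j₀] z) ≤ Λ * (R + ε) := by
        rw [Function.iterate_succ_apply', show m + 1 + j₀ = m + j₀ + 1 by ring,
          Function.iterate_succ_apply']
        exact (hΛ _ _).trans (by gcongr)
      have h5 := hzd (m + 1 + j₀)
      have h6 := dist_triangle (f^[m + 1 + j₀] x₀) (g^[m + 1 + j₀] z) (f^[k] x₀)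
      have h7 := dist_triangle (g^[m + 1 + j₀] z) (g^[m + 1] x) (f^[k] x₀)
      rw [dist_comm] at h5 h4
      have : 0 ≤ dist (g^[m + 1] x) (f^[k] x₀) := dist_nonneg
      linarith

theorem birkhoff_sum_le_of_shadow {f g i : X → X} {x₀ z : X} {P : ℕ} (hP : 0 < P)
    (hf : f^[P] x₀ = x₀) (hz : g^[P] z = z) {ψ u : X → ℝ}
    {α Λ R r c e ε ε₀ δ C Cu K lam q : ℝ} (hα : 0 < α)
    (hg : Continuous g)
    (hΛ0 : 0 ≤ Λ) (hΛf : ∀ x y, dist (f x) (f y) ≤ Λ * dist x y)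
    (hΛg : ∀ x y, dist (g x) (g y) ≤ Λ * dist x y)
    (hzd : ∀ j, dist (g^[j] z) (f^[j] x₀) < ε)
    (hsep : ∀ j k, f^[j] x₀ ≠ f^[k] x₀ →
      2 * R + Λ * (R + ε) + ε ≤ dist (f^[j] x₀) (f^[k] x₀))
    (hi : MapsTo i (nonwanderingSet g) (nonwanderingSet f))
    (hig : ∀ x ∈ nonwanderingSet g, i (g x) = f (i x))
    (hid : ∀ x ∈ nonwanderingSet g, dist (i x) x < ε)
    (hK : 0 < K) (hlam : 1 < lam)
    (hrhe : ∀ x ∈ nonwanderingSet g, ∀ y ∈ nonwanderingSet g, ∀ n : ℕ,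
      (∀ m ≤ n, dist (g^[m] x) (g^[m] y) < δ) →
      ∀ m ≤ n, dist (g^[m] x) (g^[m] y) ≤
        K * (lam ^ min m (n - m))⁻¹ * (dist x y + dist (g^[n] x) (g^[n] y)))
    (hC : 0 ≤ C) (hψ : ∀ x y, |ψ x - ψ y| ≤ C * dist x y ^ α)
    (hCu : 0 ≤ Cu) (hu : HolderBoundOn Cu α (nonwanderingSet f) u)
    (hgap : ∀ x ∈ nonwanderingSet g, ψ x - q + u (i x) - u (i (g x)) ≤
      e - ε₀ * Metric.infDist (i x) (range fun j => f^[j] x₀) ^ α)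
    (hper : ∀ j, ψ (g^[j] z) - q + u (f^[j] x₀) - u (f^[j + 1] x₀) ≤ e)
    (hq : ∑ j ∈ Finset.range P, ψ (g^[j] z) ≤ P * q)
    (hr : 0 < r) (hrR : r ≤ R) (hδ : R + ε ≤ δ) (hεr : ε ≤ r / 2) (hε₀ : 0 ≤ ε₀) (he : 0 ≤ e)
    (hc : 0 ≤ c)
    (he1 : e ≤ ε₀ * (r / 2) ^ α) (he2 : e + 2 * c ≤ ε₀ * (R / 2) ^ α) (he3 : P * e ≤ c / 2)
    (hrc : C * (K * (4 * r)) ^ α * (2 * (1 - (lam⁻¹) ^ α)⁻¹) +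
      Cu * ((2 * r) ^ α + (Λ * (2 * r)) ^ α) ≤ c / 2)
    {x : X} (hx : x ∈ nonwanderingSet g) (n : ℕ) :
    ∑ k ∈ Finset.range n, (ψ (g^[k] x) - q +
      {y | R ≤ Metric.infDist y (range fun j => f^[j] x₀)}.indicator (fun _ => c) (g^[k] x)) ≤
      u (i (g^[n] x)) - u (i x) + c := by
  set O : Set X := range fun j => f^[j] x₀ with hO
  set F : Set X := {y | R ≤ Metric.infDist y O} with hF
  have hOn : O.Nonempty := range_nonempty _
  have hxk : ∀ k, g^[k] x ∈ nonwanderingSet g := fun k =>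
    (mapsTo_nonwanderingSet hg).iterate k hx
  set b : ℕ → ℝ := fun k => ψ (g^[k] x) - q + F.indicator (fun _ => c) (g^[k] x) +
    u (i (g^[k] x)) - u (i (g^[k + 1] x)) with hb
  suffices h : ∑ k ∈ Finset.range n, b k ≤ c by
    have h2 : ∑ k ∈ Finset.range n, b k = ∑ k ∈ Finset.range n, (ψ (g^[k] x) - q +
        F.indicator (fun _ => c) (g^[k] x)) - (u (i (g^[n] x)) - u (i x)) := by
      have := Finset.sum_range_sub (fun k => u (i (g^[k] x))) n
      simp only [Function.iterate_zero, id] at this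
      rw [← this, ← Finset.sum_sub_distrib]
      exact Finset.sum_congr rfl fun k _ => by simp only [hb]; ring
    linarith
  have hgap' : ∀ k, ψ (g^[k] x) - q + u (i (g^[k] x)) - u (i (g^[k + 1] x)) ≤
      e - ε₀ * Metric.infDist (i (g^[k] x)) O ^ α := fun k => by
    rw [Function.iterate_succ_apply']
    exact hgap _ (hxk k)
  have hfar : ∀ k s, r ≤ s → s ≤ Metric.infDist (g^[k] x) O →
      ψ (g^[k] x) - q + u (i (g^[k] x)) - u (i (g^[k + 1] x)) ≤ e - ε₀ * (s / 2) ^ α := by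
    intro k s hrs hs
    refine (hgap' k).trans ?_
    have h1 : Metric.infDist (g^[k] x) O ≤ Metric.infDist (i (g^[k] x)) O + _ :=
      Metric.infDist_le_infDist_add_dist
    rw [dist_comm] at h1
    have h2 := hid _ (hxk k)
    gcongr
    · linarith
    · linarith
  refine sum_range_le_of_excursions (D := fun k => Metric.infDist (g^[k] x) O) hc hrR ?_ ?_ ?_ n
  · intro k hk
    by_cases hkR : R ≤ Metric.infDist (g^[k] x) O
    · have h1 := hfar k R hrR hkR
      have : g^[k] x ∈ F := hkR
      simp only [hb, indicator_of_mem this]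
      linarith
    · have h1 := hfar k r le_rfl hk
      have : g^[k] x ∉ F := hkR
      simp only [hb, indicator_of_notMem this]
      linarith
  · intro k hkR
    have h1 := hfar k R hrR hkR
    have : g^[k] x ∈ F := hkR
    simp only [hb, indicator_of_mem this]
    linarith
  · intro a n' han hDa hDn hD
    obtain ⟨N, rfl⟩ := Nat.exists_eq_add_of_le han
    obtain ⟨_, ⟨j₀, rfl⟩, hj₀⟩ := (Metric.infDist_lt_iff hOn).1 hDa
    obtain ⟨_, ⟨j₁, rfl⟩, hj₁⟩ := (Metric.infDist_lt_iff hOn).1 hDn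
    simp only at hj₀ hj₁
    obtain ⟨y, hy⟩ : ∃ y, y = g^[a] x := ⟨_, rfl⟩
    rw [← hy] at hDa hj₀
    have hya : ∀ m, g^[m] y = g^[a + m] x := fun m => by
      rw [hy, ← Function.iterate_add_apply, add_comm]
    have hyΩ : ∀ m, g^[m] y ∈ nonwanderingSet g := fun m => by rw [hya]; exact hxk _
    have hDy : ∀ m ≤ N, Metric.infDist (g^[m] y) O < R := fun m hm => by
      rw [hya]; exact hD _ (by lia) (by lia)
    have hsh := dist_iterate_lt_of_shadow hΛ0 hΛg hzd hsep (hj₀.trans_le hrR) hDy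
    have hε0 : 0 < ε := dist_nonneg.trans_lt (hzd 0)
    rw [← hya] at hj₁
    have hend : f^[N + j₀] x₀ = f^[j₁] x₀ := by
      by_contra hne
      have h1 := hsep _ _ hne
      have h2 := hsh N le_rfl
      have h3 := dist_triangle_left (f^[N + j₀] x₀) (f^[j₁] x₀) (g^[N] y)
      have hR0 : 0 < R := hr.trans_le hrR
      have : 0 ≤ Λ * (R + ε) := by positivity
      linarith
    rw [← hend] at hj₁
    have hd : ∀ m s, dist (g^[m] y) (f^[m + j₀] x₀) < s →
        dist (g^[m] y) (g^[m] (g^[j₀] z)) < s + ε := fun m s hs => by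
      rw [← Function.iterate_add_apply g]
      have := dist_triangle_right (g^[m] y) (g^[m + j₀] z) (f^[m + j₀] x₀)
      linarith [hzd (m + j₀)]
    have hz' : g^[j₀] z ∈ nonwanderingSet g :=
      mem_nonwanderingSet_of_iterate_eq hP (iterate_iterate_eq hz j₀)
    have hexp := hrhe y (hyΩ 0) _ hz' N fun m hm => (hd m R (hsh m hm)).trans_le hδ
    have hends : dist y (g^[j₀] z) + dist (g^[N] y) (g^[N] (g^[j₀] z)) ≤ 4 * r := by
      have h1 := hd N r hj₁
      have h2 := hd 0 r (by simpa using hj₀)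
      simp only [Function.iterate_zero, id] at h2
      linarith
    have hS1 := sum_le_of_two_sided_decay (C := C) (ρ := 4 * r) (n := N)
      (w := fun m => ψ (g^[m] y) - ψ (g^[m] (g^[j₀] z)))
      (d := fun m => dist (g^[m] y) (g^[m] (g^[j₀] z))) hα hC hK.le hlam (by positivity)
      (fun _ => dist_nonneg) (fun m => (le_abs_self _).trans (hψ _ _))
      (fun m hm => (hexp m hm).trans (by gcongr))
    set E : ℕ → ℝ := fun j => ψ (g^[j] z) - q + u (f^[j] x₀) - u (f^[j + 1] x₀) with hE
    have hEper : ∀ j, E (j + P) = E j := fun j => by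
      simp only [hE]
      rw [show j + P + 1 = j + 1 + P by ring]
      simp only [Function.iterate_add_apply _ _ P, hf, hz]
    have hEsum : ∑ j ∈ Finset.range P, E j ≤ 0 := by
      have h1 : ∑ j ∈ Finset.range P, E j = ∑ j ∈ Finset.range P, ψ (g^[j] z) - P * q -
          (u (f^[P] x₀) - u x₀) := by
        have := Finset.sum_range_sub (fun k => u (f^[k] x₀)) P
        simp only [Function.iterate_zero, id] at this
        rw [← this]
        have h2 : (P : ℝ) * q = ∑ j ∈ Finset.range P, q := by simp
        rw [h2, ← Finset.sum_sub_distrib, ← Finset.sum_sub_distrib]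
        exact Finset.sum_congr rfl fun k _ => by simp only [hE]; ring
      rw [h1, hf]
      linarith
    have hS2 := sum_range_le_of_periodic (e := fun m => E (m + j₀)) hP
      (fun j => by rw [add_right_comm]; exact hEper _)
      (by rw [sum_range_shift_eq_of_periodic hEper]; exact hEsum) he (fun j => hper _) (N + 1)
    have hxO : ∀ j, f^[j] x₀ ∈ nonwanderingSet f := fun j =>
      mem_nonwanderingSet_of_iterate_eq hP (iterate_iterate_eq hf j)
    have hu1 : u (i y) - u (f^[j₀] x₀) ≤ Cu * (2 * r) ^ α := by
      refine (le_abs_self _).trans ((hu _ (hi (hyΩ 0)) _ (hxO _)).trans ?_)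
      have h1 := dist_triangle (i y) y (f^[j₀] x₀)
      have h2 := hid y (hyΩ 0)
      gcongr
      change dist (i y) _ ≤ _
      linarith
    have hu2 : u (f^[N + j₀ + 1] x₀) - u (i (g^[N + 1] y)) ≤ Cu * (Λ * (2 * r)) ^ α := by
      refine (le_abs_self _).trans ((hu _ (hxO _) _ (hi (hyΩ _))).trans ?_)
      have h1 := dist_triangle_left (f^[N + j₀] x₀) (i (g^[N] y)) (g^[N] y)
      have h2 := hid _ (hyΩ N)
      rw [dist_comm] at h2
      have h3 : dist (f^[N + j₀ + 1] x₀) (i (g^[N + 1] y)) ≤ Λ * (2 * r) := by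
        rw [Function.iterate_succ_apply', Function.iterate_succ_apply', hig _ (hyΩ N)]
        refine (hΛf _ _).trans ?_
        gcongr
        linarith
      gcongr
    have hsum : ∑ k ∈ Finset.Ico a (a + N + 1), b k =
        ∑ m ∈ Finset.range (N + 1), (ψ (g^[m] y) - ψ (g^[m] (g^[j₀] z))) +
        ∑ m ∈ Finset.range (N + 1), E (m + j₀) + (u (i y) - u (f^[j₀] x₀)) +
        (u (f^[N + j₀ + 1] x₀) - u (i (g^[N + 1] y))) := by
      rw [Finset.sum_Ico_eq_sum_range, show a + N + 1 - a = N + 1 by lia]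
      have t1 := Finset.sum_range_sub (fun m => u (i (g^[m] y))) (N + 1)
      have t2 := Finset.sum_range_sub (fun m => u (f^[m + j₀] x₀)) (N + 1)
      simp only [Function.iterate_zero, id, zero_add] at t1 t2
      rw [show N + 1 + j₀ = N + j₀ + 1 by ring] at t2
      have t3 : u (i y) - u (f^[j₀] x₀) + (u (f^[N + j₀ + 1] x₀) - u (i (g^[N + 1] y))) =
          ∑ m ∈ Finset.range (N + 1), (u (f^[m + 1 + j₀] x₀) - u (f^[m + j₀] x₀)) -
          ∑ m ∈ Finset.range (N + 1), (u (i (g^[m + 1] y)) - u (i (g^[m] y))) := by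
        rw [t1, t2]; ring
      rw [add_assoc, t3, ← Finset.sum_add_distrib, ← Finset.sum_sub_distrib,
        ← Finset.sum_add_distrib]
      refine Finset.sum_congr rfl fun m hm => ?_
      have hm' : m ≤ N := Nat.lt_succ_iff.1 (Finset.mem_range.1 hm)
      have hnF : g^[m] y ∉ F := not_le.2 (hDy m hm')
      simp only [hb, hE]
      rw [add_assoc a m 1, ← hya, ← hya, indicator_of_notMem hnF,
        ← Function.iterate_add_apply g m j₀, add_right_comm m 1 j₀]
      ring
    rw [hsum]
    linarith

theorem infDist_iterate_le_of_shadow {f g : X → X} {x₀ z : X} {P : ℕ} (hP : 0 < P)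
    (hz : g^[P] z = z) {Λ R ε δ K lam : ℝ} (hΛ0 : 0 ≤ Λ)
    (hΛ : ∀ x y, dist (g x) (g y) ≤ Λ * dist x y)
    (hzd : ∀ j, dist (g^[j] z) (f^[j] x₀) < ε)
    (hsep : ∀ j k, f^[j] x₀ ≠ f^[k] x₀ →
      2 * R + Λ * (R + ε) + ε ≤ dist (f^[j] x₀) (f^[k] x₀))
    (hK : 0 < K) (hlam : 1 < lam)
    (hrhe : ∀ x ∈ nonwanderingSet g, ∀ y ∈ nonwanderingSet g, ∀ n : ℕ,
      (∀ m ≤ n, dist (g^[m] x) (g^[m] y) < δ) →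
      ∀ m ≤ n, dist (g^[m] x) (g^[m] y) ≤
        K * (lam ^ min m (n - m))⁻¹ * (dist x y + dist (g^[n] x) (g^[n] y)))
    (hδ : R + ε ≤ δ) {x : X} (hx : x ∈ nonwanderingSet g)
    (hnear : ∀ k, Metric.infDist (g^[k] x) (range fun j => f^[j] x₀) < R) (n : ℕ) :
    Metric.infDist (g^[n] x) (range fun j => g^[j] z) ≤ K * (2 * (R + ε)) * (lam⁻¹) ^ n := by
  obtain ⟨_, ⟨j₀, rfl⟩, hj₀⟩ := (Metric.infDist_lt_iff (range_nonempty _)).1 (hnear 0)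
  have hsh := dist_iterate_lt_of_shadow (n := n + n) hΛ0 hΛ hzd hsep hj₀ fun m _ => hnear m
  have hd : ∀ m ≤ n + n, dist (g^[m] x) (g^[m] (g^[j₀] z)) < R + ε := fun m hm => by
    rw [← Function.iterate_add_apply g]
    have h1 := dist_triangle_right (g^[m] x) (g^[m + j₀] z) (f^[m + j₀] x₀)
    have h2 : dist (g^[m] x) (f^[m + j₀] x₀) < R := hsh m hm
    linarith [hzd (m + j₀)]
  have hz' : g^[j₀] z ∈ nonwanderingSet g :=
    mem_nonwanderingSet_of_iterate_eq hP (iterate_iterate_eq hz j₀)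
  have h := hrhe x hx _ hz' (n + n) (fun m hm => (hd m hm).trans_le hδ) n (by lia)
  rw [Nat.add_sub_cancel, min_self] at h
  have h0 : dist x (g^[j₀] z) < R + ε := hd 0 (by lia)
  have hmem : g^[n] (g^[j₀] z) ∈ range fun j => g^[j] z :=
    ⟨n + j₀, Function.iterate_add_apply g n j₀ z⟩
  calc Metric.infDist (g^[n] x) (range fun j => g^[j] z)
      ≤ dist (g^[n] x) (g^[n] (g^[j₀] z)) := Metric.infDist_le_dist_of_mem hmem
    _ ≤ _ := h
    _ ≤ K * (lam ^ n)⁻¹ * (2 * (R + ε)) := by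
      have h1 := hd (n + n) le_rfl
      have : 0 < lam := by linarith
      gcongr
      linarith
    _ = K * (2 * (R + ε)) * (lam⁻¹) ^ n := by rw [inv_pow]; ring

end Comparison

section PeriodicMeasure

variable {X : Type*} [MeasurableSpace X]

theorem IsInvProb.eq_smul_sum_dirac {g : X → X} (hg : Measurable g) {z : X} {P : ℕ} (hP : 0 < P)
    (hz : g^[P] z = z) {ν : Measure X} (hν : IsInvProb g ν)
    (hsupp : ∀ᵐ x ∂ν, ∃ j, g^[j] z = x) :
    ν = (P : ENNReal)⁻¹ • ∑ m ∈ Finset.range P, Measure.dirac (g^[m] z) := by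
  have := hν.1
  have hp : MeasurePreserving g ν ν := ⟨hg, hν.2⟩
  ext A hA
  have h1 : (P : ENNReal) * ν A = ∑ m ∈ Finset.range P, A.indicator 1 (g^[m] z) := by
    calc (P : ENNReal) * ν A = ∑ m ∈ Finset.range P, ∫⁻ x, A.indicator 1 (g^[m] x) ∂ν := by
          rw [← nsmul_eq_mul, ← Finset.card_range P, ← Finset.sum_const, Finset.card_range]
          refine Finset.sum_congr rfl fun m _ => ?_
          rw [(hp.iterate m).lintegral_comp (measurable_one.indicator hA),
            lintegral_indicator_one hA]
      _ = ∫⁻ x, ∑ m ∈ Finset.range P, A.indicator 1 (g^[m] x) ∂ν :=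
          (lintegral_finsetSum _ fun m _ =>
            (measurable_one.indicator hA).comp (hg.iterate m)).symm
      _ = ∫⁻ _, ∑ m ∈ Finset.range P, A.indicator 1 (g^[m] z) ∂ν := by
          refine lintegral_congr_ae ?_
          filter_upwards [hsupp] with x ⟨j, hj⟩
          subst hj
          have := sum_range_shift_eq_of_periodic (P := P)
            (e := fun m => A.indicator (1 : X → ENNReal) (g^[m] z))
            (fun j => by rw [Function.iterate_add_apply, hz]) j
          simpa only [Function.iterate_add_apply] using this
      _ = _ := by simp
  have hP0 : (P : ENNReal) ≠ 0 := by exact_mod_cast hP.ne'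
  rw [Measure.smul_apply, Measure.finsetSum_apply, smul_eq_mul]
  simp only [Measure.dirac_apply' _ hA]
  rw [← h1, ← mul_assoc, ENNReal.inv_mul_cancel hP0 (ENNReal.natCast_ne_top P), one_mul]

theorem IsPeriodicOrbit.isInvProb_orbitMeasure [DecidableEq X] {g : X → X} (hg : Measurable g)
    {O : Finset X} (hO : IsPeriodicOrbit g O) : IsInvProb g (orbitMeasure O) := by
  obtain ⟨z, P, hP, hz, hOz⟩ := hO
  have hne : O.Nonempty := by
    rw [hOz]
    exact (Finset.nonempty_range_iff.2 hP.ne').image _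
  have himg : O.image g = O := by
    refine (Finset.eq_of_subset_of_card_le (fun y hy => ?_) Finset.card_image_le).symm
    rw [hOz] at hy ⊢
    obtain ⟨m, hm, rfl⟩ := Finset.mem_image.1 hy
    simp only [Finset.image_image, Finset.mem_image, Function.comp]
    cases m with
    | zero =>
      refine ⟨P - 1, by simp [hP], ?_⟩
      rw [← Function.iterate_succ_apply' g, Nat.succ_eq_add_one, Nat.sub_add_cancel hP, hz]
      rfl
    | succ m =>
      have := Finset.mem_range.1 hm
      exact ⟨m, Finset.mem_range.2 (by lia), by rw [← Function.iterate_succ_apply' g]⟩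
  have hinj : Set.InjOn g O := Finset.injOn_of_card_image_eq (by rw [himg])
  have hcard0 : (O.card : ENNReal) ≠ 0 := by exact_mod_cast hne.card_pos.ne'
  constructor
  · constructor
    rw [orbitMeasure, Measure.smul_apply, Measure.finsetSum_apply]
    simp [ENNReal.inv_mul_cancel hcard0]
  · ext A hA
    rw [Measure.map_apply hg hA]
    simp only [orbitMeasure, Measure.smul_apply, Measure.finsetSum_apply,
      Measure.dirac_apply' _ hA, Measure.dirac_apply' _ (hg hA)]
    congr 1
    conv_rhs => rw [← himg, Finset.sum_image hinj]
    rfl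

variable [MetricSpace X] [BorelSpace X]

theorem ae_orbitMeasure_mem (O : Finset X) : ∀ᵐ x ∂orbitMeasure O, x ∈ O := by
  refine Measure.ae_smul_measure ?_ _
  rw [ae_iff, Measure.finsetSum_apply]
  refine Finset.sum_eq_zero fun x hx => ?_
  rw [← ae_iff, ae_dirac_iff (by exact O.measurableSet)]
  exact hx

theorem orbitMeasure_eq_smul_sum_dirac [DecidableEq X] {g : X → X} (hg : Measurable g) {z : X}
    {P : ℕ} (hP : 0 < P) (hz : g^[P] z = z) :
    orbitMeasure ((Finset.range P).image fun j => g^[j] z) =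
      (P : ENNReal)⁻¹ • ∑ m ∈ Finset.range P, Measure.dirac (g^[m] z) := by
  have hO : IsPeriodicOrbit g ((Finset.range P).image fun j => g^[j] z) := ⟨z, P, hP, hz, rfl⟩
  refine (hO.isInvProb_orbitMeasure hg).eq_smul_sum_dirac hg hP hz ?_
  filter_upwards [ae_orbitMeasure_mem _] with x hx
  obtain ⟨j, -, hj⟩ := Finset.mem_image.1 hx
  exact ⟨j, hj⟩

theorem mul_integral_orbitMeasure [DecidableEq X] {g : X → X} (hg : Measurable g) {z : X}
    {P : ℕ} (hP : 0 < P) (hz : g^[P] z = z) (ψ : X → ℝ) :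
    P * ∫ x, ψ x ∂orbitMeasure ((Finset.range P).image fun j => g^[j] z) =
      ∑ j ∈ Finset.range P, ψ (g^[j] z) := by
  rw [orbitMeasure_eq_smul_sum_dirac hg hP hz, integral_smul_measure,
    integral_finsetSum_measure fun _ _ => integrable_dirac (by simp)]
  have : (P : ℝ) ≠ 0 := by exact_mod_cast hP.ne'
  simp [integral_dirac, this]

theorem maxMeasures_eq_singleton [CompactSpace X] [DecidableEq X] {g : X → X} (hg : Continuous g)
    {z : X} {P : ℕ} (hP : 0 < P) (hz : g^[P] z = z) {ψ : X → ℝ} (hψ : Continuous ψ) {q : ℝ}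
    (hq : ∑ j ∈ Finset.range P, ψ (g^[j] z) = P * q) {c B A lam : ℝ} (hc : 0 < c)
    (hlam : 1 < lam) {F : Set X} (hF : MeasurableSet F)
    (hbound : ∀ x ∈ nonwanderingSet g, ∀ n,
      ∑ k ∈ Finset.range n, (ψ (g^[k] x) - q + F.indicator (fun _ => c) (g^[k] x)) ≤ B)
    (hdecay : ∀ x ∈ nonwanderingSet g, (∀ k, g^[k] x ∉ F) → ∀ n,
      Metric.infDist (g^[n] x) (range fun j => g^[j] z) ≤ A * (lam⁻¹) ^ n) :
    maxMeasures g ψ = {orbitMeasure ((Finset.range P).image fun j => g^[j] z)} := by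
  set O : Finset X := (Finset.range P).image fun j => g^[j] z with hO
  have hOper : IsPeriodicOrbit g O := ⟨z, P, hP, hz, rfl⟩
  have hinv := hOper.isInvProb_orbitMeasure hg.measurable
  have hint : ∫ x, ψ x ∂orbitMeasure O = q := by
    have h := mul_integral_orbitMeasure hg.measurable hP hz ψ
    rw [hq] at h
    exact mul_left_cancel₀ (by exact_mod_cast hP.ne') h
  have hle : ∀ ν : Measure X, IsInvProb g ν → ∫ x, ψ x ∂ν - q + c * ν.real F ≤ 0 := by
    intro ν hν
    have := hν.1
    have hp : MeasurePreserving g ν ν := ⟨hg.measurable, hν.2⟩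
    have hψi : Integrable ψ ν :=
      hψ.integrable_of_hasCompactSupport (HasCompactSupport.of_compactSpace _)
    have hFi : Integrable (F.indicator fun _ => c) ν := (integrable_const c).indicator hF
    have hψq : Integrable (fun x => ψ x - q) ν := hψi.sub (integrable_const q)
    set w : X → ℝ := fun x => ψ x - q + F.indicator (fun _ => c) x with hw
    have hwi : Integrable w ν := hψq.add hFi
    have hwint : ∫ x, w x ∂ν = ∫ x, ψ x ∂ν - q + c * ν.real F := by
      rw [hw, integral_add hψq hFi, integral_sub hψi (integrable_const q),
        integral_indicator_const _ hF]
      simp [mul_comm]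
    have hcomp : ∀ k, ∫ x, w (g^[k] x) ∂ν = ∫ x, w x ∂ν := fun k => by
      conv_rhs => rw [← (hp.iterate k).map_eq]
      refine (integral_map (hp.iterate k).measurable.aemeasurable ?_).symm
      rw [(hp.iterate k).map_eq]
      exact hwi.aestronglyMeasurable
    have hn : ∀ n : ℕ, n * ∫ x, w x ∂ν ≤ B := by
      intro n
      calc n * ∫ x, w x ∂ν = ∑ k ∈ Finset.range n, ∫ x, w (g^[k] x) ∂ν := by simp [hcomp]
        _ = ∫ x, ∑ k ∈ Finset.range n, w (g^[k] x) ∂ν :=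
            (integral_finsetSum _ fun k _ =>
              (hp.iterate k).integrable_comp_of_integrable hwi).symm
        _ ≤ ∫ _, B ∂ν := by
            refine integral_mono_ae (integrable_finsetSum _ fun k _ =>
              (hp.iterate k).integrable_comp_of_integrable hwi) (integrable_const B) ?_
            filter_upwards [hν.ae_mem_nonwanderingSet hg] with x hx
            exact hbound x hx n
        _ = B := by simp
    rw [← hwint]
    by_contra! hpos
    obtain ⟨n, hn'⟩ := exists_nat_gt (B / ∫ x, w x ∂ν)
    rw [div_lt_iff₀ hpos] at hn'
    exact absurd (hn n) (not_le.2 hn')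
  have hmax : maxErgAvg g ψ = q := by
    refine IsGreatest.csSup_eq ⟨⟨_, hinv, hint.symm⟩, ?_⟩
    rintro _ ⟨ν, hν, rfl⟩
    have := hle ν hν
    have : 0 ≤ c * ν.real F := by positivity
    linarith
  refine Subset.antisymm ?_ ?_
  · rintro ν ⟨hν, hνq⟩
    have := hν.1
    have hp : MeasurePreserving g ν ν := ⟨hg.measurable, hν.2⟩
    rw [hmax] at hνq
    have hF0 : ν F = 0 := by
      have h1 := hle ν hν
      rw [hνq, sub_self, zero_add] at h1
      have h2 : ν.real F = 0 :=
        le_antisymm (by by_contra! h; exact absurd h1 (not_le.2 (mul_pos hc h)))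
          measureReal_nonneg
      exact (measureReal_eq_zero_iff (by finiteness)).1 h2
    have hFk : ∀ᵐ x ∂ν, ∀ k, g^[k] x ∉ F := by
      rw [ae_all_iff]
      intro k
      have := (hp.iterate k).measure_preimage hF.nullMeasurableSet
      rw [hF0] at this
      exact measure_eq_zero_iff_ae_notMem.1 this
    have hcl : IsClosed (range fun j => g^[j] z) := (finite_range_iterate hP hz).isClosed
    have hdi : Continuous fun x => Metric.infDist x (range fun j => g^[j] z) :=
      Metric.continuous_infDist_pt _
    have hdi' : Integrable (fun x => Metric.infDist x (range fun j => g^[j] z)) ν :=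
      hdi.integrable_of_hasCompactSupport (HasCompactSupport.of_compactSpace _)
    have hzero : ∫ x, Metric.infDist x (range fun j => g^[j] z) ∂ν = 0 := by
      refine le_antisymm ?_ (integral_nonneg fun _ => Metric.infDist_nonneg)
      have hlim : Tendsto (fun n : ℕ => A * (lam⁻¹) ^ n) atTop (nhds 0) := by
        have := (tendsto_pow_atTop_nhds_zero_of_lt_one (by positivity)
          (inv_lt_one_of_one_lt₀ hlam)).const_mul A
        simpa using this
      refine ge_of_tendsto' hlim fun n => ?_
      calc ∫ x, Metric.infDist x (range fun j => g^[j] z) ∂ν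
          = ∫ x, Metric.infDist (g^[n] x) (range fun j => g^[j] z) ∂ν := by
            conv_lhs => rw [← (hp.iterate n).map_eq]
            exact integral_map (hp.iterate n).measurable.aemeasurable hdi.aestronglyMeasurable
        _ ≤ ∫ _, A * (lam⁻¹) ^ n ∂ν := by
            refine integral_mono_ae ((hp.iterate n).integrable_comp_of_integrable hdi')
              (integrable_const _) ?_
            filter_upwards [hν.ae_mem_nonwanderingSet hg, hFk] with x hx hx'
            exact hdecay x hx hx' n
        _ = A * (lam⁻¹) ^ n := by simp
    have hsupp : ∀ᵐ x ∂ν, ∃ j, g^[j] z = x := by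
      have := (integral_eq_zero_iff_of_nonneg (fun _ => Metric.infDist_nonneg) hdi').1 hzero
      filter_upwards [this] with x hx
      exact (hcl.mem_iff_infDist_zero (range_nonempty _)).2 hx
    rw [mem_singleton_iff, orbitMeasure_eq_smul_sum_dirac hg.measurable hP hz]
    exact hν.eq_smul_sum_dirac hg.measurable hP hz hsupp
  · rintro _ rfl
    exact ⟨hinv, hint.trans hmax.symm⟩

end PeriodicMeasure

/-- **Interior condition**: a stably hyperbolic map together with a nonconstant
locked Hölder potential lies in the interior of the joint locking set. -/
theorem interior_of_joint_locking_set
    {X : Type*} [MetricSpace X] [CompactSpace X] [MeasurableSpace X] [BorelSpace X]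
    [DecidableEq X] {F : Type*} [TopologicalSpace F]
    (ι : F → X → X) (hlip : ∀ g : F, ∃ K : NNReal, LipschitzWith K (ι g))
    (α : ℝ) (hα0 : 0 < α) (hα1 : α ≤ 1)
    (f : F) (hsh : StablyHyperbolic ι f)
    (φ : X → ℝ) (hφ : IsHolderOn α Set.univ φ) (hnc : ∃ x y, φ x ≠ φ y)
    (hlock : HasLocking α (ι f) φ) :
    ∃ U ∈ nhds f, ∃ ε > (0:ℝ), ∀ g ∈ U, ∀ ψ : X → ℝ, IsHolderOn α Set.univ ψ →
      holderNormOn α Set.univ (fun x => ψ x - φ x) < ε → HasLocking α (ι g) ψ := by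
  have hfc : ∀ g : F, Continuous (ι g) := fun g => (hlip g).choose_spec.continuous
  obtain ⟨⟨O, ⟨x₀, P, hP, hx₀, rfl⟩, hmax⟩, εl, hεl, hlk⟩ := hlock
  obtain ⟨hIS, ⟨U₁, hU₁, K, hK, δ, hδ, lam, hlam, hRHE⟩, hML⟩ := hsh
  obtain ⟨Cφ, hCφ0, hCφ'⟩ := hφ.exists_nonneg
  have hCφ : ∀ x y, |φ x - φ y| ≤ Cφ * dist x y ^ α := fun x y => hCφ' x trivial y trivial
  set S : Set X := range fun j => (ι f)^[j] x₀ with hS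
  set D : X → ℝ := fun x => Metric.infDist x S ^ α with hD
  have hD0 : ∀ x, 0 ≤ D x := fun x => Real.rpow_nonneg Metric.infDist_nonneg _
  have hDH : ∀ x y, |D x - D y| ≤ dist x y ^ α := abs_infDist_rpow_sub_le hα0 hα1 S
  have hDS : ∀ j, D ((ι f)^[j] x₀) = 0 := fun j => by
    simp only [hD]
    rw [Metric.infDist_zero_of_mem (show (ι f)^[j] x₀ ∈ S from ⟨j, rfl⟩), Real.zero_rpow hα0.ne']
  obtain ⟨ε₀, hε₀, u, Q, Cu, hCu0, hQ, hu, hCu⟩ : ∃ ε₀ > (0 : ℝ), ∃ u : X → ℝ, ∃ Q Cu : ℝ,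
      0 ≤ Cu ∧ P * Q = ∑ j ∈ Finset.range P, φ ((ι f)^[j] x₀) ∧
      (∀ y ∈ nonwanderingSet (ι f), φ y + ε₀ * D y + u y - u (ι f y) ≤ Q) ∧
      HolderBoundOn Cu α (nonwanderingSet (ι f)) u := by
    have hDc : Continuous D :=
      continuous_of_holder (C := 1) hα0 fun x y => by simpa using hDH x y
    obtain ⟨M, hM⟩ := isCompact_univ.exists_bound_of_continuousOn hDc.continuousOn
    have hM0 : 0 ≤ M := (norm_nonneg _).trans (hM x₀ trivial)
    set ε₀ : ℝ := εl / (2 * (M + 1)) with hε₀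
    have hε₀pos : 0 < ε₀ := by positivity
    have hφ₁ : IsHolderOn α univ fun x => φ x + ε₀ * D x := by
      refine ⟨Cφ + ε₀, fun x _ y _ => ?_⟩
      calc |φ x + ε₀ * D x - (φ y + ε₀ * D y)| = |(φ x - φ y) + ε₀ * (D x - D y)| := by
            congr 1; ring
        _ ≤ |φ x - φ y| + |ε₀ * (D x - D y)| := abs_add_le _ _
        _ ≤ Cφ * dist x y ^ α + ε₀ * dist x y ^ α := by
            rw [abs_mul, abs_of_pos hε₀pos]
            gcongr
            · exact hCφ x y
            · exact hDH x y
        _ = _ := by ring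
    have hnorm : holderNormOn α univ (fun x => φ x + ε₀ * D x - φ x) < εl := by
      have h1 : holderNormOn α univ (fun x => φ x + ε₀ * D x - φ x) ≤ ε₀ * M + ε₀ := by
        refine holderNormOn_le (by positivity) hε₀pos.le (fun x => ?_) fun x y => ?_
        · rw [add_sub_cancel_left, abs_mul, abs_of_pos hε₀pos]
          gcongr
          exact hM x trivial
        · rw [add_sub_cancel_left, add_sub_cancel_left, ← mul_sub, abs_mul, abs_of_pos hε₀pos]
          gcongr
          exact hDH x y
      have h2 : ε₀ * M + ε₀ = εl / 2 := by rw [hε₀]; field_simp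
      linarith
    have hmax₁ := (hlk _ hφ₁ hnorm).trans hmax
    obtain ⟨L, -, hL⟩ := hML α hα0 hα1
    obtain ⟨u, hu, hCu⟩ := hL _ hφ₁
    refine ⟨ε₀, hε₀pos, u, _, max (L * holderSemiOn α univ fun x => φ x + ε₀ * D x) 0,
      le_max_right _ _, ?_, hu, fun x hx y hy => (hCu x hx y hy).trans ?_⟩
    · have hmem : orbitMeasure ((Finset.range P).image fun i => (ι f)^[i] x₀) ∈
          maxMeasures (ι f) fun x => φ x + ε₀ * D x := by rw [hmax₁]; rfl
      rw [← hmem.2, mul_integral_orbitMeasure (hfc f).measurable hP hx₀]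
      simp [hDS]
    · gcongr
      exact le_max_left _ _
  set Λ : ℝ := 2 * lipConst (ι f) with hΛ
  have hlf0 := lipConst_nonneg (ι f)
  have hΛ0 : 0 ≤ Λ := by positivity
  obtain ⟨s, hs0, hs⟩ := (finite_range_iterate hP hx₀).exists_pos_le_dist
  obtain ⟨R, hR0, hRs, hRδ⟩ : ∃ R > (0 : ℝ), 2 * R + Λ * (R + R) + R ≤ s ∧ R + R ≤ δ := by
    refine ⟨min (s / (3 + 2 * Λ)) (δ / 2), by positivity, ?_, ?_⟩
    · have h1 := min_le_left (s / (3 + 2 * Λ)) (δ / 2)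
      rw [le_div_iff₀ (by positivity)] at h1
      linarith
    · linarith [min_le_right (s / (3 + 2 * Λ)) (δ / 2)]
  set c : ℝ := ε₀ * (R / 2) ^ α / 4 with hc
  have hc0 : 0 < c := by positivity
  obtain ⟨r, hr0, hrR, hrc⟩ : ∃ r > (0 : ℝ), r ≤ R ∧
      (Cφ + 1) * (K * (4 * r)) ^ α * (2 * (1 - (lam⁻¹) ^ α)⁻¹) +
        Cu * ((2 * r) ^ α + (Λ * (2 * r)) ^ α) ≤ c / 2 := by
    have hcont : Continuous fun r : ℝ =>
        (Cφ + 1) * (K * (4 * r)) ^ α * (2 * (1 - (lam⁻¹) ^ α)⁻¹) +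
          Cu * ((2 * r) ^ α + (Λ * (2 * r)) ^ α) := by
      have hpow := Real.continuous_rpow_const hα0.le
      fun_prop
    have h0 := hcont.tendsto 0
    simp only [mul_zero, Real.zero_rpow hα0.ne', zero_mul, add_zero] at h0
    have h1 := (h0.mono_left (nhdsWithin_le_nhds (s := Ioi 0))).eventually_le_const
      (show 0 < c / 2 by positivity)
    obtain ⟨r, hr, hr0, hrR⟩ := (h1.and (Ioc_mem_nhdsGT hR0)).exists
    exact ⟨r, hr0, hrR, hr⟩
  obtain ⟨ε, hε0, hε1, hεr, he1, he2, he3⟩ : ∃ ε > (0 : ℝ), ε ≤ 1 ∧ ε ≤ r / 2 ∧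
      2 * (ε + Cφ * ε ^ α) ≤ ε₀ * (r / 2) ^ α ∧ 2 * (ε + Cφ * ε ^ α) ≤ 2 * c ∧
      P * (2 * (ε + Cφ * ε ^ α)) ≤ c / 2 := by
    have hcont : Continuous fun ε : ℝ => 2 * (ε + Cφ * ε ^ α) := by
      have hpow := Real.continuous_rpow_const hα0.le
      fun_prop
    have h0 := hcont.tendsto 0
    simp only [mul_zero, Real.zero_rpow hα0.ne', add_zero] at h0
    have h1 := h0.mono_left (nhdsWithin_le_nhds (s := Ioi 0))
    have h2 := h1.const_mul (P : ℝ)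
    rw [mul_zero] at h2
    obtain ⟨ε, ha, hb, hd, hε0, hε⟩ :=
      ((h1.eventually_le_const (show 0 < ε₀ * (r / 2) ^ α by positivity)).and
        ((h1.eventually_le_const (show 0 < 2 * c by positivity)).and
          ((h2.eventually_le_const (show 0 < c / 2 by positivity)).and
            (Ioc_mem_nhdsGT (show 0 < min 1 (r / 2) by positivity))))).exists
    exact ⟨ε, hε0, hε.trans (min_le_left _ _), hε.trans (min_le_right _ _), ha, hb, hd⟩
  obtain ⟨U, hU, hUg⟩ := hIS ε hε0
  refine ⟨U ∩ U₁, inter_mem hU hU₁, ε / 2, by positivity, ?_⟩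
  rintro g ⟨hgU, hgU₁⟩
  obtain ⟨hlg, h, i, hh, hi, hhf, hig, hhd, hid⟩ := hUg g hgU
  set e : ℝ := 2 * (ε + Cφ * ε ^ α) with he
  have hfx : ∀ j, (ι f)^[j] x₀ ∈ nonwanderingSet (ι f) := fun j =>
    mem_nonwanderingSet_of_iterate_eq hP (iterate_iterate_eq hx₀ j)
  have hgz : ∀ j, (ι g)^[j] (h x₀) = h ((ι f)^[j] x₀) := by
    intro j
    induction j with
    | zero => rfl
    | succ j ih =>
      rw [Function.iterate_succ_apply', Function.iterate_succ_apply', ih, hhf _ (hfx j)]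
  have hz : (ι g)^[P] (h x₀) = h x₀ := by rw [hgz, hx₀]
  have hzd : ∀ j, dist ((ι g)^[j] (h x₀)) ((ι f)^[j] x₀) < ε := fun j => by
    rw [hgz]; exact hhd _ (hfx j)
  have hεR : ε ≤ R := by linarith
  have hsep : ∀ j k, (ι f)^[j] x₀ ≠ (ι f)^[k] x₀ →
      2 * R + Λ * (R + ε) + ε ≤ dist ((ι f)^[j] x₀) ((ι f)^[k] x₀) := fun j k hjk => by
    have h1 := hs _ (mem_range_self j) _ (mem_range_self k) hjk
    have h2 : Λ * (R + ε) ≤ Λ * (R + R) := by gcongr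
    linarith
  have hΛf : ∀ x y, dist (ι f x) (ι f y) ≤ Λ * dist x y := fun x y =>
    (dist_map_le_lipConst (hlip f) x y).trans (by gcongr; linarith)
  have hΛg : ∀ x y, dist (ι g x) (ι g y) ≤ Λ * dist x y := fun x y =>
    (dist_map_le_lipConst (hlip g) x y).trans (by gcongr)
  have key : ∀ ψ : X → ℝ, (∀ x, |ψ x - φ x| ≤ ε) →
      (∀ x y, |ψ x - φ x - (ψ y - φ y)| ≤ ε * dist x y ^ α) →
      maxMeasures (ι g) ψ =
        {orbitMeasure ((Finset.range P).image fun j => (ι g)^[j] (h x₀))} := by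
    intro ψ hψ1 hψ2
    have hψC : ∀ x y, |ψ x - ψ y| ≤ (Cφ + 1) * dist x y ^ α := fun x y => by
      calc |ψ x - ψ y| = |(φ x - φ y) + (ψ x - φ x - (ψ y - φ y))| := by congr 1; ring
        _ ≤ |φ x - φ y| + |ψ x - φ x - (ψ y - φ y)| := abs_add_le _ _
        _ ≤ Cφ * dist x y ^ α + ε * dist x y ^ α := add_le_add (hCφ x y) (hψ2 x y)
        _ ≤ Cφ * dist x y ^ α + 1 * dist x y ^ α := by gcongr
        _ = _ := by ring
    have hclose : ∀ x y, dist x y < ε → |ψ x - φ y| ≤ e / 2 := fun x y hxy => by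
      calc |ψ x - φ y| = |(ψ x - φ x) + (φ x - φ y)| := by congr 1; ring
        _ ≤ |ψ x - φ x| + |φ x - φ y| := abs_add_le _ _
        _ ≤ ε + Cφ * ε ^ α := by
            refine add_le_add (hψ1 x) ((hCφ x y).trans ?_)
            gcongr
        _ = e / 2 := by rw [he]; ring
    have hP0 : (0 : ℝ) < P := by exact_mod_cast hP
    set q : ℝ := (∑ j ∈ Finset.range P, ψ ((ι g)^[j] (h x₀))) / P with hq
    have hPq : ∑ j ∈ Finset.range P, ψ ((ι g)^[j] (h x₀)) = P * q := by
      rw [hq]; field_simp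
    have hQq : Q ≤ q + e / 2 := by
      have h1 : P * Q ≤ P * (q + e / 2) := by
        rw [hQ, mul_add, ← hPq, ← nsmul_eq_mul P (e / 2), ← Finset.card_range P,
          ← Finset.sum_const, Finset.card_range, ← Finset.sum_add_distrib]
        refine Finset.sum_le_sum fun j _ => ?_
        have := (abs_le.1 (hclose _ _ (hzd j))).1
        linarith
      exact le_of_mul_le_mul_left h1 hP0
    refine maxMeasures_eq_singleton (hfc g) hP hz (continuous_of_holder hα0 hψC) hPq
      (F := {y | R ≤ Metric.infDist y S}) (B := Cu * Metric.diam (univ : Set X) ^ α + c)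
      (A := K * (2 * (R + ε))) hc0 hlam
      (isClosed_le continuous_const (Metric.continuous_infDist_pt _)).measurableSet ?_ ?_
    · intro x hx n
      have hb := birkhoff_sum_le_of_shadow (i := i) (u := u) (ε₀ := ε₀) (e := e) hP hx₀ hz hα0
        (hfc g) hΛ0 hΛf hΛg hzd hsep hi hig hid hK hlam (hRHE g hgU₁) (by positivity) hψC hCu0 hCu
        (fun y hy => by
          have h1 := (abs_le.1 (hclose y (i y) (by rw [dist_comm]; exact hid y hy))).2
          have h2 := hu _ (hi hy)
          rw [hig y hy]
          simp only [hD] at h2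
          linarith)
        (fun j => by
          have h1 := (abs_le.1 (hclose _ _ (hzd j))).2
          have h2 := hu _ (hfx j)
          rw [hDS, ← Function.iterate_succ_apply' (ι f)] at h2
          linarith)
        hPq.le hr0 hrR (by linarith) hεr hε₀.le (by positivity) hc0.le he1 (by linarith) he3 hrc
        hx n
      refine hb.trans ?_
      have hxn : (ι g)^[n] x ∈ nonwanderingSet (ι g) :=
        (mapsTo_nonwanderingSet (hfc g)).iterate n hx
      have h1 : u (i ((ι g)^[n] x)) - u (i x) ≤ Cu * Metric.diam (univ : Set X) ^ α := by
        refine (le_abs_self _).trans ((hCu _ (hi hxn) _ (hi hx)).trans ?_)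
        gcongr
        exact Metric.dist_le_diam_of_mem isCompact_univ.isBounded trivial trivial
      linarith
    · intro x hx hxF n
      exact infDist_iterate_le_of_shadow hP hz hΛ0 hΛg hzd hsep hK hlam (hRHE g hgU₁)
        (by linarith) hx (fun k => not_le.1 (hxF k)) n
  intro ψ hψ hψn
  obtain ⟨hb1, hb2⟩ := bounds_of_holderNormOn_lt hα0 (hψ.sub hφ) hψn
  have hkψ := key ψ (fun x => (hb1 x).trans (by linarith))
    fun x y => (hb2 x y).trans (by gcongr; linarith)
  refine ⟨⟨_, ⟨h x₀, P, hP, hz, rfl⟩, hkψ⟩, ε / 2, by positivity, fun ψ' hψ' hψn' => ?_⟩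
  obtain ⟨hb1', hb2'⟩ := bounds_of_holderNormOn_lt hα0 (hψ'.sub hψ) hψn'
  rw [hkψ]
  refine key ψ' (fun x => ?_) fun x y => ?_
  · calc |ψ' x - φ x| = |(ψ' x - ψ x) + (ψ x - φ x)| := by congr 1; ring
      _ ≤ |ψ' x - ψ x| + |ψ x - φ x| := abs_add_le _ _
      _ ≤ ε := by linarith [hb1 x, hb1' x]
  · calc |ψ' x - φ x - (ψ' y - φ y)|
        = |(ψ' x - ψ x - (ψ' y - ψ y)) + (ψ x - φ x - (ψ y - φ y))| := by congr 1; ring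
      _ ≤ |ψ' x - ψ x - (ψ' y - ψ y)| + |ψ x - φ x - (ψ y - φ y)| := abs_add_le _ _
      _ ≤ ε * dist x y ^ α := by linarith [hb2 x y, hb2' x y]
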